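/- (Modal Kochen–Specker theorem.) Let L be an orthomodular lattice, let (W_i)_{i∈I} be the family of all Boolean sublattices of L, let M be a Boolean saturated orthomodular lattice with an embedding e : L → M (an injective map preserving ∧, ∨, ¬, 0, 1), and let ◇L denote the possibility space, i.e. the subalgebra of M generated by {◇(e(p)) : p ∈ L}. Then L admits a global valuation if and only if there exists a Boolean homomorphism f : ◇L → 2 that admits a compatible actualization, i.e. a global valuation (v_i : W_i → 2)_{i∈I} of L such that for every i ∈ I and every x ∈ W_i with e(x) ∈ ◇L one has v_i(x) = f(e(x)). -/

import Mathlib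

universe u

/-- An orthomodular structure on a bounded lattice: an involutive De Morgan
orthocomplement satisfying the orthomodular law. -/
class OrthoStructure (α : Type u) [Lattice α] [BoundedOrder α] where
  ocompl : α → α
  ocompl_ocompl : ∀ x : α, ocompl (ocompl x) = x
  ocompl_sup : ∀ x y : α, ocompl (x ⊔ y) = ocompl x ⊓ ocompl y
  inf_ocompl : ∀ x : α, x ⊓ ocompl x = ⊥
  orthomodular : ∀ x y : α, x ⊔ (ocompl x ⊓ (x ⊔ y)) = x ⊔ y

open OrthoStructure

variable {α : Type u} [Lattice α] [BoundedOrder α] [OrthoStructure α]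

/-- Both distributive identities for the ordered triple `(x, y, w)`. -/
def DistribTriple (x y w : α) : Prop :=
  (x ⊔ y) ⊓ w = (x ⊓ w) ⊔ (y ⊓ w) ∧ (x ⊓ y) ⊔ w = (x ⊔ w) ⊓ (y ⊔ w)

/-- `z` is central: both distributive identities hold for every permutation of `(a, b, z)`. -/
def IsCentral (z : α) : Prop :=
  ∀ a b : α, DistribTriple a b z ∧ DistribTriple a z b ∧ DistribTriple b a z ∧
    DistribTriple b z a ∧ DistribTriple z a b ∧ DistribTriple z b a

/-- The center `Z(α)` of an orthomodular lattice. -/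
def center (α : Type u) [Lattice α] [BoundedOrder α] [OrthoStructure α] : Set α :=
  {z | IsCentral z}

/-- A Boolean saturated orthomodular lattice: every element has a smallest
central element `dia p` above it. -/
class BooleanSaturated (α : Type u) [Lattice α] [BoundedOrder α] [OrthoStructure α] where
  dia : α → α
  dia_least : ∀ p : α, IsLeast {z : α | IsCentral z ∧ p ≤ z} (dia p)

open BooleanSaturated


/-- The subalgebra generated by a set `S`: the smallest subset containing `S`
and closed under `⊓`, `⊔`, orthocomplement, `⊥` and `⊤`. -/
inductive Gen {β : Type u} [Lattice β] [BoundedOrder β] [OrthoStructure β]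
    (S : Set β) : β → Prop
  | base {x : β} : x ∈ S → Gen S x
  | bot : Gen S ⊥
  | top : Gen S ⊤
  | inf {x y : β} : Gen S x → Gen S y → Gen S (x ⊓ y)
  | sup {x y : β} : Gen S x → Gen S y → Gen S (x ⊔ y)
  | compl {x : β} : Gen S x → Gen S (ocompl x)

/-- A Boolean sublattice: a subset containing `⊥` and `⊤`, closed under `⊓`,
`⊔` and orthocomplement, on which the distributive law holds. -/
def IsBooleanSub {β : Type u} [Lattice β] [BoundedOrder β] [OrthoStructure β]
    (W : Set β) : Prop :=
  ⊥ ∈ W ∧ ⊤ ∈ W ∧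
  (∀ x ∈ W, ∀ y ∈ W, x ⊓ y ∈ W) ∧
  (∀ x ∈ W, ∀ y ∈ W, x ⊔ y ∈ W) ∧
  (∀ x ∈ W, ocompl x ∈ W) ∧
  (∀ x ∈ W, ∀ y ∈ W, ∀ z ∈ W, x ⊓ (y ⊔ z) = (x ⊓ y) ⊔ (x ⊓ z))

/-- A Boolean homomorphism from the subset `W` into the two-element Boolean
algebra `Bool`: it preserves `⊥`, `⊤`, and `⊓`, `⊔`, orthocomplement on
elements of `W`. -/
def IsHomOn {β : Type u} [Lattice β] [BoundedOrder β] [OrthoStructure β]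
    (W : Set β) (f : β → Bool) : Prop :=
  f ⊥ = false ∧ f ⊤ = true ∧
  (∀ x ∈ W, ∀ y ∈ W, f (x ⊓ y) = (f x && f y)) ∧
  (∀ x ∈ W, ∀ y ∈ W, f (x ⊔ y) = (f x || f y)) ∧
  (∀ x ∈ W, f (ocompl x) = !f x)

/-- A global valuation: a family of Boolean homomorphisms, one for each Boolean
sublattice, agreeing on intersections. -/
def IsGlobalValuation {β : Type u} [Lattice β] [BoundedOrder β] [OrthoStructure β]
    (v : Set β → β → Bool) : Prop :=
  (∀ W : Set β, IsBooleanSub W → IsHomOn W (v W)) ∧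
  (∀ W₁ W₂ : Set β, IsBooleanSub W₁ → IsBooleanSub W₂ →
    ∀ x ∈ W₁ ∩ W₂, v W₁ x = v W₂ x)

theorem ocompl_inf (x y : α) : ocompl (x ⊓ y) = ocompl x ⊔ ocompl y := by
  rw [← ocompl_ocompl (ocompl x ⊔ ocompl y), ocompl_sup, ocompl_ocompl, ocompl_ocompl]

theorem ocompl_top : ocompl (⊤ : α) = ⊥ := by
  simpa using inf_ocompl (⊤ : α)

theorem sup_ocompl (x : α) : x ⊔ ocompl x = ⊤ := by
  rw [← ocompl_ocompl (x ⊔ ocompl x), ocompl_sup, inf_ocompl, ← ocompl_top, ocompl_ocompl]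

theorem DistribTriple.symm {β : Type u} [Lattice β] {x y w : β} (h : DistribTriple x y w) :
    DistribTriple y x w :=
  ⟨by rw [sup_comm, h.1, sup_comm], by rw [inf_comm, h.2, inf_comm]⟩

theorem DistribTriple.ocompl {x y w : α} (h : DistribTriple x y w) :
    DistribTriple (ocompl x) (ocompl y) (ocompl w) := by
  constructor
  · rw [← ocompl_inf, ← ocompl_sup, h.2, ocompl_inf, ocompl_sup, ocompl_sup]
  · rw [← ocompl_sup, ← ocompl_inf, h.1, ocompl_sup, ocompl_inf, ocompl_inf]

theorem isCentral_iff {β : Type u} [Lattice β] {z : β} :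
    IsCentral z ↔ ∀ a b : β, DistribTriple a b z ∧ DistribTriple a z b :=
  ⟨fun h a b => ⟨(h a b).1, (h a b).2.1⟩, fun h a b =>
    ⟨(h a b).1, (h a b).2, (h b a).1, (h b a).2, (h a b).2.symm, (h b a).2.symm⟩⟩

theorem IsCentral.bot {β : Type u} [Lattice β] [BoundedOrder β] : IsCentral (⊥ : β) := by
  simp [IsCentral, DistribTriple]

theorem IsCentral.top {β : Type u} [Lattice β] [BoundedOrder β] : IsCentral (⊤ : β) := by
  simp [IsCentral, DistribTriple]

theorem IsCentral.ocompl {z : α} (hz : IsCentral z) : IsCentral (ocompl z) := by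
  rw [isCentral_iff] at hz ⊢
  intro a b
  have h := hz (OrthoStructure.ocompl a) (OrthoStructure.ocompl b)
  have h₁ := h.1.ocompl
  have h₂ := h.2.ocompl
  rw [ocompl_ocompl, ocompl_ocompl] at h₁ h₂
  exact ⟨h₁, h₂⟩

theorem IsCentral.inf {β : Type u} [Lattice β] {z w : β} (hz : IsCentral z)
    (hw : IsCentral w) : IsCentral (z ⊓ w) := by
  have sup_inf (c : β) : (z ⊓ w) ⊔ c = (z ⊔ c) ⊓ (w ⊔ c) := (hz w c).2.2.2.2.1.2
  rw [isCentral_iff]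
  refine fun a b => ⟨⟨?_, ?_⟩, ⟨?_, ?_⟩⟩
  · rw [← inf_assoc, (hz a b).1.1, (hw _ _).1.1, inf_assoc, inf_assoc]
  · rw [sup_comm, sup_inf, sup_comm z, sup_comm w, (hz a b).1.2, (hw a b).1.2,
      sup_comm a (z ⊓ w), sup_comm b (z ⊓ w), sup_inf, sup_inf, sup_comm z, sup_comm z,
      sup_comm w, sup_comm w, inf_inf_inf_comm]
  · have h₁ : (a ⊓ b) ⊔ (z ⊓ w ⊓ b) = (a ⊓ b ⊔ z) ⊓ (a ⊓ b ⊔ w ⊓ b) := by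
      rw [inf_assoc, sup_comm, (hz (w ⊓ b) (a ⊓ b)).2.2.2.2.1.2, sup_comm z,
        sup_comm (w ⊓ b)]
    rw [h₁, (hz a b).1.2, ← (hw a b).2.1.1, sup_comm a (z ⊓ w), sup_inf, sup_comm z,
      sup_comm w, inf_assoc, inf_assoc, inf_left_comm (b ⊔ z),
      inf_eq_right.2 (le_sup_left : b ≤ b ⊔ z)]
  · rw [← inf_assoc, (hw (a ⊓ z) b).2.1.2, (hz a b).2.1.2, sup_inf, inf_assoc]

theorem IsCentral.sup {z w : α} (hz : IsCentral z) (hw : IsCentral w) : IsCentral (z ⊔ w) := by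
  rw [← ocompl_ocompl (z ⊔ w), ocompl_sup]
  exact (hz.ocompl.inf hw.ocompl).ocompl

theorem Gen.isCentral {S : Set α} (hS : ∀ x ∈ S, IsCentral x) {x : α} (hx : Gen S x) :
    IsCentral x := by
  induction hx with
  | base h => exact hS _ h
  | bot => exact .bot
  | top => exact .top
  | inf _ _ h₁ h₂ => exact h₁.inf h₂
  | sup _ _ h₁ h₂ => exact h₁.sup h₂
  | compl _ h => exact h.ocompl

theorem isBooleanSub_gen {S : Set α} (hS : ∀ x ∈ S, IsCentral x) :
    IsBooleanSub {x : α | Gen S x} :=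
  ⟨.bot, .top, fun _ hx _ hy => .inf hx hy, fun _ hx _ hy => .sup hx hy, fun _ hx => .compl hx,
    fun x hx y _ z _ => by
      rw [inf_comm, (Gen.isCentral hS hx y z).1.1, inf_comm y, inf_comm z]⟩

/-- A Boolean sublattice, as a distributive lattice in its own right. -/
abbrev IsBooleanSub.distribLattice {W : Set α} (hW : IsBooleanSub W) : DistribLattice W :=
  letI : Lattice W := Subtype.lattice (fun _ _ hx hy => hW.2.2.2.1 _ hx _ hy)
    (fun _ _ hx hy => hW.2.2.1 _ hx _ hy)
  .ofInfSupLe fun a b c => (hW.2.2.2.2.2 a a.2 b b.2 c c.2).le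

theorem IsHomOn.mono {W : Set α} {g : α → Bool} (hg : IsHomOn W g) {x y : α} (hx : x ∈ W)
    (hy : y ∈ W) (hxy : x ≤ y) (h : g x = true) : g y = true := by
  have := hg.2.2.1 x hx y hy
  rw [inf_eq_left.2 hxy, h, Bool.true_and] at this
  exact this.symm

/-- A two-valued homomorphism on a Boolean sublattice extends to any larger Boolean sublattice. -/
theorem IsHomOn.exists_extension {B C : Set α} (hB : IsBooleanSub B) (hC : IsBooleanSub C)
    (hBC : B ⊆ C) {g : α → Bool} (hg : IsHomOn B g) :
    ∃ f : α → Bool, IsHomOn C f ∧ ∀ x ∈ B, f x = g x := by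
  classical
  let := hC.distribLattice
  have hF : Order.IsPFilter {y : C | ∃ x ∈ B, g x = true ∧ x ≤ y} := by
    refine .of_def ⟨⟨⊤, hC.2.1⟩, ⊤, hB.2.1, hg.2.1, le_rfl⟩ ?_ ?_
    · rintro a ⟨x, hx, hgx, hxa⟩ b ⟨y, hy, hgy, hyb⟩
      refine ⟨a ⊓ b, ⟨x ⊓ y, hB.2.2.1 x hx y hy, ?_, inf_le_inf hxa hyb⟩,
        inf_le_left, inf_le_right⟩
      rw [hg.2.2.1 x hx y hy, hgx, hgy, Bool.and_self]
    · rintro a b hab ⟨x, hx, hgx, hxa⟩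
      exact ⟨x, hx, hgx, hxa.trans hab⟩
  have hI : Order.IsIdeal {y : C | ∃ x ∈ B, g x = false ∧ y ≤ x} := by
    refine ⟨?_, ⟨⟨⊥, hC.1⟩, ⊥, hB.1, hg.1, le_rfl⟩, ?_⟩
    · rintro a b hba ⟨x, hx, hgx, hax⟩
      exact ⟨x, hx, hgx, le_trans (show (b : α) ≤ a from hba) hax⟩
    · rintro a ⟨x, hx, hgx, hax⟩ b ⟨y, hy, hgy, hby⟩
      refine ⟨a ⊔ b, ⟨x ⊔ y, hB.2.2.2.1 x hx y hy, ?_, sup_le_sup hax hby⟩,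
        le_sup_left, le_sup_right⟩
      rw [hg.2.2.2.1 x hx y hy, hgx, hgy, Bool.or_self]
  have hFI : Disjoint (hF.toPFilter : Set C) (hI.toIdeal : Set C) := by
    refine Set.disjoint_left.2 ?_
    rintro a ⟨x, hx, hgx, hxa⟩ ⟨y, hy, hgy, hay⟩
    exact Bool.false_ne_true (hgy.symm.trans (hg.mono hx hy (le_trans hxa hay) hgx))
  obtain ⟨J, hJ, hIJ, hFJ⟩ := DistribLattice.prime_ideal_of_disjoint_filter_ideal hFI
  have hJB : ∀ x (hx : x ∈ B), (⟨x, hBC hx⟩ : C) ∈ J ↔ g x = false := by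
    refine fun x hx => ⟨fun h => ?_, fun h => hIJ ⟨x, hx, h, le_rfl⟩⟩
    by_contra hgx
    exact Set.disjoint_left.1 hFJ ⟨x, hx, by simpa using hgx, le_rfl⟩ h
  have hbot : (⟨⊥, hC.1⟩ : C) ∈ J := (hJB ⊥ hB.1).2 hg.1
  have htop : (⟨⊤, hC.2.1⟩ : C) ∉ J := fun h =>
    Bool.false_ne_true (((hJB ⊤ hB.2.1).1 h).symm.trans hg.2.1)
  have hinf : ∀ a b : C, a ⊓ b ∈ J ↔ a ∈ J ∨ b ∈ J := fun a b =>
    ⟨hJ.mem_or_mem, fun h => h.elim (J.lower inf_le_left) (J.lower inf_le_right)⟩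
  have hsup : ∀ a b : C, a ⊔ b ∈ J ↔ a ∈ J ∧ b ∈ J := fun a b => Order.Ideal.sup_mem_iff
  have hcompl : ∀ x (hx : x ∈ C), (⟨ocompl x, hC.2.2.2.2.1 x hx⟩ : C) ∈ J ↔
      (⟨x, hx⟩ : C) ∉ J := by
    intro x hx
    constructor
    · intro h h'
      refine htop ?_
      convert (hsup _ _).2 ⟨h', h⟩ using 1
      exact Subtype.ext (sup_ocompl x).symm
    · refine ((hinf ⟨x, hx⟩ ⟨ocompl x, hC.2.2.2.2.1 x hx⟩).1 ?_).resolve_left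
      convert hbot using 1
      exact Subtype.ext (inf_ocompl x)
  let f : α → Bool := fun x => decide (∃ h : x ∈ C, (⟨x, h⟩ : C) ∉ J)
  have hf : ∀ x (hx : x ∈ C), f x = !decide ((⟨x, hx⟩ : C) ∈ J) := by
    intro x hx
    simp [f, hx]
  refine ⟨f, ⟨?_, ?_, fun x hx y hy => ?_, fun x hx y hy => ?_, fun x hx => ?_⟩, fun x hx => ?_⟩
  · simp [hf ⊥ hC.1, hbot]
  · simp [hf ⊤ hC.2.1, htop]
  · rw [hf _ (hC.2.2.1 x hx y hy), hf x hx, hf y hy, ← Bool.not_or, ← Bool.decide_or]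
    exact congrArg _ (decide_eq_decide.2 (hinf ⟨x, hx⟩ ⟨y, hy⟩))
  · rw [hf _ (hC.2.2.2.1 x hx y hy), hf x hx, hf y hy, ← Bool.not_and, ← Bool.decide_and]
    exact congrArg _ (decide_eq_decide.2 (hsup ⟨x, hx⟩ ⟨y, hy⟩))
  · rw [hf _ (hC.2.2.2.2.1 x hx), hf x hx, decide_eq_decide.2 (hcompl x hx), decide_not]
  · simp [hf x (hBC hx), hJB x hx]

/-- **Modal Kochen–Specker theorem.** Let `e : α → M` embed the orthomodular
lattice `α` into a Boolean saturated orthomodular lattice `M`, and let the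
possibility space `◇L` be the subalgebra of `M` generated by `{◇(e p) : p ∈ α}`.
Then `α` admits a global valuation iff some Boolean homomorphism
`f : ◇L → 2` admits a compatible actualization. -/
theorem modal_kochen_specker {M : Type u} [Lattice M] [BoundedOrder M]
    [OrthoStructure M] [BooleanSaturated M]
    (e : α → M) (he : Function.Injective e)
    (hinf : ∀ x y : α, e (x ⊓ y) = e x ⊓ e y)
    (hsup : ∀ x y : α, e (x ⊔ y) = e x ⊔ e y)
    (hcompl : ∀ x : α, e (ocompl x) = ocompl (e x))
    (hbot : e ⊥ = ⊥) (htop : e ⊤ = ⊤) :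
    (∃ v : Set α → α → Bool, IsGlobalValuation v) ↔
    (∃ f : M → Bool,
      IsHomOn {x : M | Gen (Set.range fun p : α => dia (e p)) x} f ∧
      ∃ v : Set α → α → Bool, IsGlobalValuation v ∧
        ∀ W : Set α, IsBooleanSub W → ∀ x ∈ W,
          Gen (Set.range fun p : α => dia (e p)) (e x) → v W x = f (e x)) := by
  constructor
  · rintro ⟨v, hv⟩
    have hC : IsBooleanSub {x : M | Gen (Set.range fun p : α => dia (e p)) x} :=
      isBooleanSub_gen (by rintro _ ⟨p, rfl⟩; exact (dia_least (e p)).1.1)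
    set C := {x : M | Gen (Set.range fun p : α => dia (e p)) x}
    have hB : IsBooleanSub (e ⁻¹' C) := by
      obtain ⟨h₁, h₂, h₃, h₄, h₅, h₆⟩ := hC
      refine ⟨?_, ?_, fun x hx y hy => ?_, fun x hx y hy => ?_, fun x hx => ?_,
        fun x hx y hy z hz => he ?_⟩
      · rwa [Set.mem_preimage, hbot]
      · rwa [Set.mem_preimage, htop]
      · rw [Set.mem_preimage, hinf]; exact h₃ _ hx _ hy
      · rw [Set.mem_preimage, hsup]; exact h₄ _ hx _ hy
      · rw [Set.mem_preimage, hcompl]; exact h₅ _ hx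
      · simp only [hinf, hsup]; exact h₆ _ hx _ hy _ hz
    have hB' : IsBooleanSub (e '' (e ⁻¹' C)) := by
      obtain ⟨h₁, h₂, h₃, h₄, h₅, -⟩ := hB
      refine ⟨⟨⊥, h₁, hbot⟩, ⟨⊤, h₂, htop⟩, ?_, ?_, ?_, ?_⟩
      · rintro _ ⟨x, hx, rfl⟩ _ ⟨y, hy, rfl⟩
        exact ⟨_, h₃ x hx y hy, hinf x y⟩
      · rintro _ ⟨x, hx, rfl⟩ _ ⟨y, hy, rfl⟩
        exact ⟨_, h₄ x hx y hy, hsup x y⟩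
      · rintro _ ⟨x, hx, rfl⟩
        exact ⟨_, h₅ x hx, hcompl x⟩
      · rintro _ ⟨x, hx, rfl⟩ _ ⟨y, hy, rfl⟩ _ ⟨z, hz, rfl⟩
        exact hC.2.2.2.2.2 _ hx _ hy _ hz
    have : Nonempty α := ⟨⊥⟩
    have hinv := Function.leftInverse_invFun he
    have hg : IsHomOn (e '' (e ⁻¹' C)) fun y => v (e ⁻¹' C) (Function.invFun e y) := by
      obtain ⟨h₁, h₂, h₃, h₄, h₅⟩ := hv.1 _ hB
      refine ⟨?_, ?_, ?_, ?_, ?_⟩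
      · simpa only [← hbot, hinv _] using h₁
      · simpa only [← htop, hinv _] using h₂
      · rintro _ ⟨x, hx, rfl⟩ _ ⟨y, hy, rfl⟩
        simpa only [← hinf, hinv _] using h₃ x hx y hy
      · rintro _ ⟨x, hx, rfl⟩ _ ⟨y, hy, rfl⟩
        simpa only [← hsup, hinv _] using h₄ x hx y hy
      · rintro _ ⟨x, hx, rfl⟩
        simpa only [← hcompl, hinv _] using h₅ x hx
    obtain ⟨f, hf, hfg⟩ := hg.exists_extension hB' hC (Set.image_preimage_subset e C)
    refine ⟨f, hf, v, hv, fun W hW x hxW hx => ?_⟩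
    rw [hfg (e x) ⟨x, hx, rfl⟩, hinv x]
    exact hv.2 W _ hW hB x ⟨hxW, hx⟩
  · rintro ⟨_, _, v, hv, _⟩
    exact ⟨v, hv⟩
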